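/- arXiv:1610.03144 — 2 statements merged into one kernel-verified Lean document; each statement's English description precedes it below -/
import Mathlib

section
/- Let n ≥ 1, let Ω ⊂ ℝⁿ be a bounded open set, let p > 2, let λ ≥ 1, and let u₀, v₀ ∈ X with v₀ ≥ λu₀ on Ω̄. For each integer j ≥ 1, if u_j and v_j are classical solutions of the j-th regularized problem with data u₀ and v₀ respectively, then v_j(x,t) ≥ λ u_j(x,t) for all (x,t) ∈ Ω̄ × [0,∞). (Consequently, the global viscosity solutions u = sup_j u_j and v = sup_j v_j satisfy v ≥ λu.) -/
open Set Filter Metric MeasureTheory Topology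
open scoped ENNReal

noncomputable section

/-- Euclidean space ℝⁿ. -/
abbrev Euc (n : ℕ) := EuclideanSpace ℝ (Fin n)

/-- Membership in the class `X` of `C¹(Ω̄)` functions that are nonnegative on `Ω̄`
and vanish on `∂Ω`. -/
def MemX {n : ℕ} (Ω : Set (Euc n)) (v : Euc n → ℝ) : Prop :=
  ContDiffOn ℝ 1 v (closure Ω) ∧ (∀ x ∈ closure Ω, 0 ≤ v x) ∧ ∀ x ∈ frontier Ω, v x = 0

/-- The regularized Hamiltonian `F_j(ξ) = min(|ξ|^p, j^{p-2}|ξ|²)`. -/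
def Fj (n : ℕ) (p : ℝ) (j : ℕ) (ξ : Euc n) : ℝ :=
  min (‖ξ‖ ^ p) ((j : ℝ) ^ (p - 2) * ‖ξ‖ ^ 2)

/-- The Laplacian, as the sum of the second partial derivatives. -/
def lap (n : ℕ) (f : Euc n → ℝ) (x : Euc n) : ℝ :=
  ∑ i : Fin n,
    fderiv ℝ (fun y => fderiv ℝ f y (EuclideanSpace.single i 1)) x (EuclideanSpace.single i 1)

/-- `u` is a classical solution of the `j`-th regularized problem
`∂ₜu = Δu + F_j(∇u)` in `Ω × (0,∞)`, `u = 0` on `∂Ω × (0,∞)`, `u(·,0) = u₀`. -/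
structure IsRegSol (n : ℕ) (p : ℝ) (Ω : Set (Euc n)) (j : ℕ) (u0 : Euc n → ℝ)
    (u : Euc n → ℝ → ℝ) : Prop where
  cont : ContinuousOn (fun q : Euc n × ℝ => u q.1 q.2) (closure Ω ×ˢ Ici (0:ℝ))
  nonneg : ∀ x ∈ closure Ω, ∀ t ∈ Ici (0:ℝ), 0 ≤ u x t
  time_reg : ∀ x ∈ Ω, ContDiffOn ℝ 1 (fun s => u x s) (Ioi (0:ℝ))
  space_reg : ∀ t ∈ Ioi (0:ℝ), ContDiffOn ℝ 2 (fun y => u y t) Ω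
  eqn : ∀ x ∈ Ω, ∀ t ∈ Ioi (0:ℝ),
    deriv (fun s => u x s) t = lap n (fun y => u y t) x + Fj n p j (gradient (fun y => u y t) x)
  bc : ∀ x ∈ frontier Ω, ∀ t ∈ Ioi (0:ℝ), u x t = 0
  ic : ∀ x ∈ closure Ω, u x 0 = u0 x

/-- The pointwise supremum `U(x,t) = sup_{j ≥ 1} u_j(x,t)` of a family of approximating
solutions; on `Ω × (0,∞)` this coincides with the global viscosity solution. -/
def Usup {n : ℕ} (u : ℕ → Euc n → ℝ → ℝ) (x : Euc n) (t : ℝ) : ℝ :=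
  ⨆ j : {j : ℕ // 1 ≤ j}, u j.1 x t

/-- The time interval `[0,T)` (as a subset of ℝ), `T ∈ (0,∞]`. -/
def TimeIcc (T : ℝ≥0∞) : Set ℝ := {t : ℝ | 0 ≤ t ∧ ENNReal.ofReal t < T}

/-- The time interval `(0,T)` (as a subset of ℝ), `T ∈ (0,∞]`. -/
def TimeIoo (T : ℝ≥0∞) : Set ℝ := {t : ℝ | 0 < t ∧ ENNReal.ofReal t < T}

/-- `u` is a classical solution of the Dirichlet problem `∂ₜu = Δu + |∇u|^p` in `Ω × (0,T)`,
`u = 0` on `∂Ω × [0,T)`, `u(·,0) = u₀`, with `u` and `∇u` continuous on `Ω̄ × [0,T)`. -/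
structure IsClassicalSol (n : ℕ) (p : ℝ) (Ω : Set (Euc n)) (u0 : Euc n → ℝ)
    (u : Euc n → ℝ → ℝ) (T : ℝ≥0∞) : Prop where
  cont : ContinuousOn (fun q : Euc n × ℝ => u q.1 q.2) (closure Ω ×ˢ TimeIcc T)
  grad_cont : ∃ G : Euc n × ℝ → Euc n, ContinuousOn G (closure Ω ×ˢ TimeIcc T) ∧
    ∀ x ∈ Ω, ∀ t ∈ TimeIoo T, G (x, t) = gradient (fun y => u y t) x
  time_reg : ∀ x ∈ Ω, ContDiffOn ℝ 1 (fun s => u x s) (TimeIoo T)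
  space_reg : ∀ t ∈ TimeIoo T, ContDiffOn ℝ 2 (fun y => u y t) Ω
  eqn : ∀ x ∈ Ω, ∀ t ∈ TimeIoo T,
    deriv (fun s => u x s) t = lap n (fun y => u y t) x + ‖gradient (fun y => u y t) x‖ ^ p
  bc : ∀ x ∈ frontier Ω, ∀ t ∈ TimeIcc T, u x t = 0
  ic : ∀ x ∈ closure Ω, u x 0 = u0 x

/-- The second derivative in the direction `e` is nonpositive at a local maximum. -/
theorem fderiv_fderiv_apply_nonpos_of_isLocalMax {E : Type*} [NormedAddCommGroup E]
    [NormedSpace ℝ E] {f : E → ℝ} {x : E} (hf : ContDiffAt ℝ 2 f x) (hx : IsLocalMax f x) (e : E) :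
    fderiv ℝ (fun y => fderiv ℝ f y e) x e ≤ 0 := by
  by_contra! hpos
  have hline : ∀ s : ℝ, HasDerivAt (fun s : ℝ => x + s • e) e s := fun s => by
    simpa using ((hasDerivAt_id s).smul_const e).const_add x
  have hcont : Tendsto (fun s : ℝ => x + s • e) (𝓝 0) (𝓝 x) := by
    simpa using (hline 0).continuousAt.tendsto
  have hdiff : ∀ᶠ y in 𝓝 x, DifferentiableAt ℝ f y :=
    (hf.eventually (by simp)).mono fun y hy => hy.differentiableAt (by simp)
  have hderiv : deriv (fun s : ℝ => f (x + s • e)) =ᶠ[𝓝 0] fun s => fderiv ℝ f (x + s • e) e :=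
    (hcont.eventually hdiff).mono fun s hs => (hs.hasFDerivAt.comp_hasDerivAt s (hline s)).deriv
  have hdiff2 : DifferentiableAt ℝ (fun y => fderiv ℝ f y e) x :=
    ((hf.fderiv_right (m := 1) (by norm_num)).differentiableAt (by simp)).clm_apply
      (differentiableAt_const e)
  have hderiv2 : deriv (deriv fun s : ℝ => f (x + s • e)) 0
      = fderiv ℝ (fun y => fderiv ℝ f y e) x e := by
    rw [hderiv.deriv_eq]
    have h0 : HasFDerivAt (fun y => fderiv ℝ f y e) (fderiv ℝ (fun y => fderiv ℝ f y e) x)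
        (x + (0 : ℝ) • e) := by simpa using hdiff2.hasFDerivAt
    exact (h0.comp_hasDerivAt (0 : ℝ) (hline 0)).deriv
  have hmax : IsLocalMax (fun s : ℝ => f (x + s • e)) 0 := by
    simpa [IsLocalMax, IsMaxFilter] using hcont.eventually hx
  have hmin : IsLocalMin (fun s : ℝ => f (x + s • e)) 0 := by
    refine isLocalMin_of_deriv_deriv_pos (hderiv2 ▸ hpos) hmax.deriv_eq_zero ?_
    have : ContinuousAt f (x + (0 : ℝ) • e) := by simpa using hf.continuousAt
    exact this.comp_of_eq (hline 0).continuousAt rfl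
  have hconst : (fun s : ℝ => f (x + s • e)) =ᶠ[𝓝 0] fun _ => f (x + (0 : ℝ) • e) := by
    filter_upwards [hmax, hmin] with s h1 h2 using le_antisymm h1 h2
  have hzero : deriv (deriv fun s : ℝ => f (x + s • e)) 0 = 0 := by
    rw [hconst.deriv.deriv_eq]
    simp
  linarith

/-- The Laplacian is nonpositive at a local maximum. -/
theorem lap_nonpos_of_isLocalMax {n : ℕ} {f : Euc n → ℝ} {x : Euc n} (hf : ContDiffAt ℝ 2 f x)
    (hx : IsLocalMax f x) : lap n f x ≤ 0 :=
  Finset.sum_nonpos fun _ _ => fderiv_fderiv_apply_nonpos_of_isLocalMax hf hx _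

theorem lap_const_mul_sub {n : ℕ} {f g : Euc n → ℝ} {x : Euc n} (c : ℝ)
    (hf : ContDiffAt ℝ 2 f x) (hg : ContDiffAt ℝ 2 g x) :
    lap n (fun y => c * f y - g y) x = c * lap n f x - lap n g x := by
  have hdiff : ∀ {h : Euc n → ℝ}, ContDiffAt ℝ 2 h x → ∀ᶠ y in 𝓝 x, DifferentiableAt ℝ h y :=
    fun hh => (hh.eventually (by simp)).mono fun y hy => hy.differentiableAt (by simp)
  have hdiff2 : ∀ {h : Euc n → ℝ}, ContDiffAt ℝ 2 h x → ∀ e,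
      DifferentiableAt ℝ (fun y => fderiv ℝ h y e) x := fun hh e =>
    ((hh.fderiv_right (m := 1) (by norm_num)).differentiableAt (by simp)).clm_apply
      (differentiableAt_const e)
  simp only [lap, Finset.mul_sum, ← Finset.sum_sub_distrib]
  refine Finset.sum_congr rfl fun i _ => ?_
  set e : Euc n := EuclideanSpace.single i 1
  have h1 : (fun y => fderiv ℝ (fun z => c * f z - g z) y e) =ᶠ[𝓝 x]
      fun y => c * fderiv ℝ f y e - fderiv ℝ g y e := by
    filter_upwards [hdiff hf, hdiff hg] with y hfy hgy
    rw [((hfy.hasFDerivAt.const_mul c).fun_sub hgy.hasFDerivAt).fderiv]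
    simp
  rw [h1.fderiv_eq,
    (((hdiff2 hf e).hasFDerivAt.const_mul c).fun_sub (hdiff2 hg e).hasFDerivAt).fderiv]
  simp

theorem mul_Fj_le_Fj_smul {n : ℕ} {p : ℝ} (hp : 1 ≤ p) (j : ℕ) {c : ℝ} (hc : 1 ≤ c) (ξ : Euc n) :
    c * Fj n p j ξ ≤ Fj n p j (c • ξ) := by
  have hc0 : 0 ≤ c := zero_le_one.trans hc
  have hcp : c ≤ c ^ p := Real.self_le_rpow_of_one_le hc hp
  have hc2 : c ≤ c ^ 2 := le_self_pow₀ hc two_ne_zero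
  unfold Fj
  rw [norm_smul, Real.norm_of_nonneg hc0, Real.mul_rpow hc0 (norm_nonneg ξ), mul_pow,
    mul_min_of_nonneg _ _ hc0]
  refine min_le_min (by gcongr) ?_
  rw [mul_left_comm]
  gcongr

/-- A differentiable function on the line that is maximal at `t` among earlier times has
nonnegative derivative at `t`. -/
theorem HasDerivAt.nonneg_of_eventually_le_left {g : ℝ → ℝ} {g' t : ℝ} (hg : HasDerivAt g g' t)
    (hmax : ∀ᶠ s in 𝓝[<] t, g s ≤ g t) : 0 ≤ g' := by
  refine ge_of_tendsto (hasDerivWithinAt_iff_tendsto_slope' self_notMem_Iio |>.1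
    (hg.hasDerivWithinAt (s := Iio t))) ?_
  filter_upwards [hmax, self_mem_nhdsWithin] with s hs hst
  rw [slope_def_field]
  exact div_nonneg_of_nonpos (sub_nonpos.2 hs) (sub_nonpos.2 (le_of_lt hst))

/-- **Lemma 3.2 of Porretta–Souplet.** If `v₀ ≥ λu₀` with `λ ≥ 1`, then for every `j ≥ 1` the
classical solutions of the `j`-th regularized problems with data `u₀` and `v₀` satisfy
`v_j ≥ λ u_j` on `Ω̄ × [0,∞)`. -/
theorem regularized_comparison_lambda (n : ℕ) (hn : 1 ≤ n)
    (Ω : Set (Euc n)) (hΩo : IsOpen Ω) (hΩb : Bornology.IsBounded Ω)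
    (p : ℝ) (hp : 2 < p) (lam : ℝ) (hlam : 1 ≤ lam)
    (u0 v0 : Euc n → ℝ) (hu0 : MemX Ω u0) (hv0 : MemX Ω v0)
    (hle : ∀ x ∈ closure Ω, lam * u0 x ≤ v0 x)
    (j : ℕ) (hj : 1 ≤ j) (uj vj : Euc n → ℝ → ℝ)
    (huj : IsRegSol n p Ω j u0 uj) (hvj : IsRegSol n p Ω j v0 vj) :
    ∀ x ∈ closure Ω, ∀ t ∈ Ici (0:ℝ), lam * uj x t ≤ vj x t := by
  rintro x hx T (hT : 0 ≤ T)
  refine le_of_forall_pos_le_add fun δ hδ => ?_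
  obtain ⟨ε, hε, hεT⟩ : ∃ ε > 0, ε * T ≤ δ := by
    refine ⟨δ / (T + 1), by positivity, ?_⟩
    rw [div_mul_eq_mul_div, div_le_iff₀ (by positivity)]
    nlinarith
  set φ : Euc n × ℝ → ℝ := fun q => lam * uj q.1 q.2 - vj q.1 q.2 - ε * q.2 with hφ
  have hK : IsCompact (closure Ω ×ˢ Icc (0 : ℝ) T) := hΩb.isCompact_closure.prod isCompact_Icc
  have hsub : closure Ω ×ˢ Icc (0 : ℝ) T ⊆ closure Ω ×ˢ Ici (0 : ℝ) :=
    prod_mono_right Icc_subset_Ici_self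
  have hφc : ContinuousOn φ (closure Ω ×ˢ Icc (0 : ℝ) T) :=
    ((continuousOn_const.mul (huj.cont.mono hsub)).sub (hvj.cont.mono hsub)).sub (by fun_prop)
  obtain ⟨⟨y, t⟩, ⟨hy, ht⟩, hmax⟩ := hK.exists_isMaxOn ⟨(x, T), hx, hT, le_rfl⟩ hφc
  have hle' : φ (x, T) ≤ φ (y, t) := hmax (mk_mem_prod hx ⟨hT, le_rfl⟩)
  suffices hφ0 : φ (y, t) ≤ 0 by
    have := hle'.trans hφ0
    simp only [hφ] at this
    linarith
  simp only at hy ht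
  rcases ht.1.eq_or_lt with rfl | ht0
  · simpa [hφ, huj.ic y hy, hvj.ic y hy] using hle y hy
  by_cases hyΩ : y ∈ Ω
  swap
  · have hyf : y ∈ frontier Ω := by rw [hΩo.frontier_eq]; exact ⟨hy, hyΩ⟩
    simp only [hφ, huj.bc y hyf t ht0, hvj.bc y hyf t ht0]
    nlinarith
  exfalso
  have hΩy : Ω ∈ 𝓝 y := hΩo.mem_nhds hyΩ
  have hu2 : ContDiffAt ℝ 2 (fun z => uj z t) y := (huj.space_reg t ht0).contDiffAt hΩy
  have hv2 : ContDiffAt ℝ 2 (fun z => vj z t) y := (hvj.space_reg t ht0).contDiffAt hΩy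
  have hspace : IsLocalMax (fun z => lam * uj z t - vj z t) y := by
    filter_upwards [hΩy] with z hz
    have : φ (z, t) ≤ φ (y, t) := hmax (mk_mem_prod (subset_closure hz) ht)
    simp only [hφ] at this
    linarith
  have hlap : lam * lap n (fun z => uj z t) y - lap n (fun z => vj z t) y ≤ 0 := by
    rw [← lap_const_mul_sub lam hu2 hv2]
    exact lap_nonpos_of_isLocalMax
      ((contDiffAt_const.mul hu2).sub hv2) hspace
  have hgrad : gradient (fun z => vj z t) y = lam • gradient (fun z => uj z t) y := by
    have h0 := hspace.hasFDerivAt_eq_zero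
      (((hu2.differentiableAt (by simp)).hasFDerivAt.const_mul lam).sub
        (hv2.differentiableAt (by simp)).hasFDerivAt)
    rw [gradient, gradient, ← sub_eq_zero.1 h0]
    simp
  have hut : HasDerivAt (fun s => uj y s) (deriv (fun s => uj y s) t) t :=
    (((huj.time_reg y hyΩ).contDiffAt (Ioi_mem_nhds ht0)).differentiableAt (by simp)).hasDerivAt
  have hvt : HasDerivAt (fun s => vj y s) (deriv (fun s => vj y s) t) t :=
    (((hvj.time_reg y hyΩ).contDiffAt (Ioi_mem_nhds ht0)).differentiableAt (by simp)).hasDerivAt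
  have htime := (((hut.const_mul lam).sub hvt).sub
    ((hasDerivAt_id t).const_mul ε)).nonneg_of_eventually_le_left (by
      filter_upwards [Ioo_mem_nhdsLT ht0] with s hs
      exact hmax (mk_mem_prod hy ⟨hs.1.le, hs.2.le.trans ht.2⟩))
  rw [huj.eqn y hyΩ t ht0, hvj.eqn y hyΩ t ht0, hgrad] at htime
  have hF := mul_Fj_le_Fj_smul (by linarith : 1 ≤ p) j hlam (gradient (fun z => uj z t) y)
  linarith

end
end

section
/- Let n ≥ 1, let Ω ⊂ ℝⁿ be a bounded open set, let p > 2 and let u₀ ∈ X. For integers 1 ≤ j ≤ k, if u_j is a classical solution of the j-th regularized problem with data u₀ and u_k is a classical solution of the k-th regularized problem with the same data u₀, then u_j(x,t) ≤ u_k(x,t) for all (x,t) ∈ Ω̄ × [0,∞); that is, the approximating solutions are nondecreasing with respect to j. -/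
open Set Filter Metric MeasureTheory Topology
open scoped ENNReal

noncomputable section

/-- Second derivative test (necessary condition at a local maximum) on the real line. -/
theorem IsLocalMax.deriv_deriv_nonpos {g : ℝ → ℝ} {a : ℝ} (h : IsLocalMax g a)
    (hc : ContinuousAt g a) : deriv (deriv g) a ≤ 0 := by
  by_contra! hpos
  have hmin := isLocalMin_of_deriv_deriv_pos hpos h.deriv_eq_zero hc
  have hconst : g =ᶠ[𝓝 a] fun _ => g a := by
    filter_upwards [h, hmin] with s h1 h2 using le_antisymm h1 h2
  have h0 : deriv (deriv g) a = 0 := by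
    rw [hconst.deriv.deriv_eq]
    simp
  exact hpos.ne' h0

/-- At an interior local maximum of a twice differentiable function, the second derivative in
any direction is nonpositive. -/
theorem IsLocalMax.fderiv_fderiv_apply_nonpos {E : Type*} [NormedAddCommGroup E]
    [NormedSpace ℝ E] {f : E → ℝ} {x : E} (h : IsLocalMax f x) (hf : ContDiffAt ℝ 2 f x)
    (e : E) : fderiv ℝ (fun y => fderiv ℝ f y e) x e ≤ 0 := by
  have hL : ∀ s : ℝ, HasDerivAt (fun s : ℝ => x + s • e) e s := fun s => by
    simpa using ((hasDerivAt_id s).smul_const e).const_add x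
  have hL0 : Tendsto (fun s : ℝ => x + s • e) (𝓝 0) (𝓝 x) := by
    simpa using (hL 0).continuousAt.tendsto
  have hd : ∀ᶠ y in 𝓝 x, DifferentiableAt ℝ f y := by
    filter_upwards [hf.eventually (by simp)] with y hy using hy.differentiableAt (by simp)
  have hg : deriv (fun s : ℝ => f (x + s • e)) =ᶠ[𝓝 0] fun s => fderiv ℝ f (x + s • e) e := by
    filter_upwards [hL0.eventually hd] with s hs
    exact (hs.hasFDerivAt.comp_hasDerivAt s (hL s)).deriv
  have hf' : DifferentiableAt ℝ (fun y => fderiv ℝ f y e) x :=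
    ((hf.fderiv_right (m := 1) (by norm_num)).differentiableAt (by simp)).clm_apply
      (differentiableAt_const e)
  have hx : x + (0 : ℝ) • e = x := by simp
  have h2 : deriv (deriv fun s : ℝ => f (x + s • e)) 0 = fderiv ℝ (fun y => fderiv ℝ f y e) x e := by
    rw [hg.deriv_eq]
    have hf0 : HasFDerivAt (fun y => fderiv ℝ f y e) (fderiv ℝ (fun y => fderiv ℝ f y e) x)
        (x + (0 : ℝ) • e) := by
      rw [hx]; exact hf'.hasFDerivAt
    exact (hf0.comp_hasDerivAt (0 : ℝ) (hL 0)).deriv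
  rw [← h2]
  refine IsLocalMax.deriv_deriv_nonpos ?_ ?_
  · filter_upwards [hL0.eventually h] with s hs
    simpa using hs
  · exact ContinuousAt.comp (g := f) (by rw [hx]; exact hf.continuousAt) (hL 0).continuousAt

/-- A function whose restriction to `(-∞, a]` has a local maximum at `a` has nonnegative
derivative there. -/
theorem IsLocalMaxOn.deriv_nonneg_of_Iic {g : ℝ → ℝ} {a : ℝ} (h : IsLocalMaxOn g (Iic a) a)
    (hg : DifferentiableAt ℝ g a) : 0 ≤ deriv g a := by
  have hy : (a - 1) - a ∈ posTangentConeAt (Iic a) a := by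
    apply sub_mem_posTangentConeAt_of_segment_subset
    rw [segment_symm, segment_eq_Icc (by linarith)]
    exact Icc_subset_Iic_self
  have := h.hasFDerivWithinAt_nonpos hg.hasDerivAt.hasFDerivAt.hasFDerivWithinAt hy
  simp at this
  linarith

/-- The Laplacian is additive on differences of `C²` functions. -/
theorem lap_sub {n : ℕ} {f g : Euc n → ℝ} {x : Euc n} (hf : ContDiffAt ℝ 2 f x)
    (hg : ContDiffAt ℝ 2 g x) : lap n (fun y => f y - g y) x = lap n f x - lap n g x := by
  unfold lap
  rw [← Finset.sum_sub_distrib]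
  refine Finset.sum_congr rfl fun i _ => ?_
  set e : Euc n := EuclideanSpace.single i 1
  have hd : ∀ {f : Euc n → ℝ}, ContDiffAt ℝ 2 f x →
      (∀ᶠ y in 𝓝 x, DifferentiableAt ℝ f y) ∧
        DifferentiableAt ℝ (fun y => fderiv ℝ f y e) x := fun {f} hf => by
    refine ⟨?_, ((hf.fderiv_right (m := 1) (by norm_num)).differentiableAt (by simp)).clm_apply
      (differentiableAt_const e)⟩
    filter_upwards [hf.eventually (by simp)] with y hy using hy.differentiableAt (by simp)
  have heq : (fun y => fderiv ℝ (fun y => f y - g y) y e) =ᶠ[𝓝 x]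
      fun y => fderiv ℝ f y e - fderiv ℝ g y e := by
    filter_upwards [(hd hf).1, (hd hg).1] with y h1 h2
    rw [fderiv_fun_sub h1 h2]
    rfl
  rw [heq.fderiv_eq, fderiv_fun_sub (hd hf).2 (hd hg).2]
  rfl

/-- The regularized Hamiltonians are nondecreasing in the index. -/
theorem Fj_mono {n : ℕ} {p : ℝ} (hp : 2 ≤ p) {j k : ℕ} (hjk : j ≤ k) (ξ : Euc n) :
    Fj n p j ξ ≤ Fj n p k ξ := by
  have h : (j : ℝ) ^ (p - 2) ≤ (k : ℝ) ^ (p - 2) :=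
    Real.rpow_le_rpow (by positivity) (by exact_mod_cast hjk) (by linarith)
  exact min_le_min le_rfl (mul_le_mul_of_nonneg_right h (by positivity))

/-- At a spatial local maximum of the difference of two regularized solutions with `j ≤ k`, the
time derivative of the `j`-th solution is at most that of the `k`-th one. -/
theorem IsRegSol.deriv_le_of_isLocalMax {n : ℕ} {p : ℝ} (hp : 2 ≤ p) {Ω : Set (Euc n)}
    (hΩ : IsOpen Ω) {j k : ℕ} (hjk : j ≤ k) {u0 v0 : Euc n → ℝ} {u v : Euc n → ℝ → ℝ}
    (hu : IsRegSol n p Ω j u0 u) (hv : IsRegSol n p Ω k v0 v) {x : Euc n} (hx : x ∈ Ω)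
    {t : ℝ} (ht : 0 < t) (hmax : IsLocalMax (fun y => u y t - v y t) x) :
    deriv (fun s => u x s) t ≤ deriv (fun s => v x s) t := by
  have hcu := (hu.space_reg t ht).contDiffAt (hΩ.mem_nhds hx)
  have hcv := (hv.space_reg t ht).contDiffAt (hΩ.mem_nhds hx)
  have hlap : lap n (fun y => u y t - v y t) x ≤ 0 :=
    Finset.sum_nonpos fun i _ => hmax.fderiv_fderiv_apply_nonpos (hcu.sub hcv) _
  rw [lap_sub hcu hcv] at hlap
  have hgrad : gradient (fun y => u y t) x = gradient (fun y => v y t) x := by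
    have h0 := hmax.fderiv_eq_zero
    rw [fderiv_fun_sub (hcu.differentiableAt (by simp)) (hcv.differentiableAt (by simp)),
      sub_eq_zero] at h0
    rw [gradient, gradient, h0]
  rw [hu.eqn x hx t ht, hv.eqn x hx t ht, hgrad]
  linarith [Fj_mono hp hjk (gradient (fun y => v y t) x)]

/-- **Monotonicity of the approximating family.** For `1 ≤ j ≤ k`, classical solutions of the
`j`-th and `k`-th regularized problems with the same data `u₀` satisfy `u_j ≤ u_k` on
`Ω̄ × [0,∞)`. -/
theorem regularized_monotone_in_j (n : ℕ) (hn : 1 ≤ n)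
    (Ω : Set (Euc n)) (hΩo : IsOpen Ω) (hΩb : Bornology.IsBounded Ω)
    (p : ℝ) (hp : 2 < p) (u0 : Euc n → ℝ) (hu0 : MemX Ω u0)
    (j k : ℕ) (hj : 1 ≤ j) (hjk : j ≤ k) (uj uk : Euc n → ℝ → ℝ)
    (huj : IsRegSol n p Ω j u0 uj) (huk : IsRegSol n p Ω k u0 uk) :
    ∀ x ∈ closure Ω, ∀ t ∈ Ici (0:ℝ), uj x t ≤ uk x t := by
  intro x hx t ht
  have key : ∀ ε > 0, uj x t - uk x t - ε * t ≤ 0 := by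
    intro ε hε
    have hK : IsCompact (closure Ω ×ˢ Icc 0 t) := hΩb.isCompact_closure.prod isCompact_Icc
    have hsub : closure Ω ×ˢ Icc 0 t ⊆ closure Ω ×ˢ Ici (0:ℝ) :=
      prod_mono_right Icc_subset_Ici_self
    have hcont : ContinuousOn (fun q : Euc n × ℝ => uj q.1 q.2 - uk q.1 q.2 - ε * q.2)
        (closure Ω ×ˢ Icc 0 t) :=
      ((huj.cont.mono hsub).sub (huk.cont.mono hsub)).sub (by fun_prop)
    obtain ⟨⟨y, s⟩, ⟨hy, hs0, hst⟩, hmax⟩ := hK.exists_isMaxOn ⟨(x, t), hx, ht, le_rfl⟩ hcont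
    simp only at hy hs0 hst
    refine (hmax (show (x, t) ∈ closure Ω ×ˢ Icc 0 t from ⟨hx, ht, le_rfl⟩)).trans ?_
    show uj y s - uk y s - ε * s ≤ 0
    rcases hs0.eq_or_lt with rfl | hs
    · simp [huj.ic y hy, huk.ic y hy]
    by_cases hyΩ : y ∈ Ω
    · exfalso
      have hspace : IsLocalMax (fun z => uj z s - uk z s) y := by
        filter_upwards [hΩo.mem_nhds hyΩ] with z hz
        have : uj z s - uk z s - ε * s ≤ uj y s - uk y s - ε * s :=
          hmax (show (z, s) ∈ closure Ω ×ˢ Icc 0 t from ⟨subset_closure hz, hs0, hst⟩)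
        linarith
      have htime : IsLocalMaxOn (fun r => uj y r - uk y r - ε * r) (Iic s) s := by
        filter_upwards [self_mem_nhdsWithin, mem_nhdsWithin_of_mem_nhds (Ioi_mem_nhds hs)]
          with r hrs hr
        exact hmax (show (y, r) ∈ closure Ω ×ˢ Icc 0 t from
          ⟨hy, (mem_Ioi.1 hr).le, (mem_Iic.1 hrs).trans hst⟩)
      have hdj : DifferentiableAt ℝ (fun r => uj y r) s :=
        ((huj.time_reg y hyΩ).contDiffAt (Ioi_mem_nhds hs)).differentiableAt (by simp)
      have hdk : DifferentiableAt ℝ (fun r => uk y r) s :=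
        ((huk.time_reg y hyΩ).contDiffAt (Ioi_mem_nhds hs)).differentiableAt (by simp)
      have hd := (hdj.hasDerivAt.sub hdk.hasDerivAt).sub ((hasDerivAt_id s).const_mul ε)
      have hnonneg := htime.deriv_nonneg_of_Iic hd.differentiableAt
      have hderiv : deriv (fun r => uj y r - uk y r - ε * r) s = _ := hd.deriv
      have hle := huj.deriv_le_of_isLocalMax hp.le hΩo hjk huk hyΩ hs hspace
      rw [hderiv] at hnonneg
      linarith
    · have hyf : y ∈ frontier Ω := by
        rw [hΩo.frontier_eq]
        exact ⟨hy, hyΩ⟩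
      rw [huj.bc y hyf s hs, huk.bc y hyf s hs]
      nlinarith
  have hlim : Tendsto (fun ε : ℝ => uj x t - uk x t - ε * t) (𝓝[>] 0) (𝓝 (uj x t - uk x t)) := by
    have : Continuous fun ε : ℝ => uj x t - uk x t - ε * t := by fun_prop
    simpa using (this.tendsto 0).mono_left nhdsWithin_le_nhds
  exact sub_nonpos.1 (le_of_tendsto hlim (eventually_mem_nhdsWithin.mono key))

end
end
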